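/- With the caterpillar construction (attribute sets a_r, a_1, …, a_m; L disjoint from a_r ∪ a_1 ∪ … ∪ a_m; A = a_r ∪ L; Z = (m−1)·|A|): if the star instance S has a solution of benefit k, then the tree instance T has a solution of benefit k + Z, obtained by assigning every internal vertex r_i the permutation o_r ++ o_l (the root's permutation o_r followed by a fixed arbitrary permutation o_l of L) and assigning each leaf w_i the permutation chosen for u_i. -/

import Mathlib

/-- Length of the longest common prefix of two lists. -/
def lcp {α : Type*} [DecidableEq α] : List α → List α → ℕ
  | a :: p, b :: q => if a = b then lcp p q + 1 else 0
  | _, _ => 0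

/-- `p` is a permutation of the finite set `s`: a duplicate-free list whose
set of elements is exactly `s`. -/
def IsPermOf {α : Type*} [DecidableEq α] (p : List α) (s : Finset α) : Prop :=
  p.Nodup ∧ p.toFinset = s

/-- Benefit of a solution of the tree (caterpillar) instance `T` with `m`
internal vertices `r_1, …, r_m` (with permutations `p 0, …, p (m-1)`) and `m`
leaves `w_1, …, w_m` (with permutations `q 0, …, q (m-1)`): the sum over the
edges `r_i r_{i+1}` and `r_i w_i` of the longest-common-prefix lengths. -/
def treeBenefit {α : Type*} [DecidableEq α] (m : ℕ) (p q : ℕ → List α) : ℕ :=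
  (∑ i ∈ Finset.range (m - 1), lcp (p i) (p (i + 1)))
    + ∑ i ∈ Finset.range m, lcp (p i) (q i)

/-- Benefit of a solution of the star instance `S` with root permutation `pr`
and leaf permutations `q 0, …, q (m-1)`. -/
def starBenefit {α : Type*} [DecidableEq α] (m : ℕ) (pr : List α)
    (q : ℕ → List α) : ℕ :=
  ∑ i ∈ Finset.range m, lcp pr (q i)

/-- A list has its full length in common with itself. -/
theorem lcp_self {α : Type*} [DecidableEq α] (p : List α) : lcp p p = p.length := by
  induction p with
  | nil => rfl
  | cons x p ih => simp [lcp, ih]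

/-- Appending to `p` a list having no element in common with `q` does not change the
longest common prefix of `p` and `q`. -/
theorem lcp_append_left_of_disjoint {α : Type*} [DecidableEq α] {p q l : List α}
    (h : l.Disjoint q) : lcp (p ++ l) q = lcp p q := by
  induction p generalizing q with
  | nil =>
    cases l with
    | nil => rfl
    | cons x l =>
      cases q with
      | nil => rfl
      | cons y q =>
        have hxy : x ≠ y := by
          rintro rfl
          exact h List.mem_cons_self List.mem_cons_self
        simp [lcp, hxy]
  | cons x p ih =>
    cases q with
    | nil => rfl
    | cons y q =>
      simp only [List.cons_append, lcp, ih (List.disjoint_of_disjoint_cons_right h)]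

/-- Concatenating permutations of disjoint sets gives a permutation of their union. -/
theorem IsPermOf.append {α : Type*} [DecidableEq α] {p l : List α} {s t : Finset α}
    (hp : IsPermOf p s) (hl : IsPermOf l t) (h : Disjoint s t) :
    IsPermOf (p ++ l) (s ∪ t) := by
  obtain ⟨hp, rfl⟩ := hp
  obtain ⟨hl, rfl⟩ := hl
  exact ⟨hp.append hl (List.disjoint_toFinset_iff_disjoint.mp h), List.toFinset_append⟩

/-- A permutation of `s` has as many entries as `s` has elements. -/
theorem IsPermOf.length_eq {α : Type*} [DecidableEq α] {p : List α} {s : Finset α}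
    (hp : IsPermOf p s) : p.length = s.card := by
  rw [← hp.2, List.toFinset_card_of_nodup hp.1]

/-- Caterpillar construction: if the star instance `S` has a solution of
benefit `k`, then the tree instance `T` has a solution of benefit
`k + Z` with `Z = (m-1)·|A|`, obtained by assigning each internal vertex the
permutation `pr ++ ol` (root's permutation followed by a fixed arbitrary
permutation `ol` of `L`), and each leaf `w_i` the permutation chosen
for `u_i`. -/
theorem stmt5 {α : Type*} [DecidableEq α] (m : ℕ) (ar L : Finset α)
    (a : ℕ → Finset α)
    (hdisj : ∀ x ∈ L, x ∉ ar ∧ ∀ i < m, x ∉ a i)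
    (k : ℕ) (pr : List α) (q : ℕ → List α)
    (hpr : IsPermOf pr ar) (hq : ∀ i < m, IsPermOf (q i) (a i))
    (hk : starBenefit m pr q = k)
    (ol : List α) (hol : IsPermOf ol L) :
    (∀ i < m, IsPermOf (pr ++ ol) (ar ∪ L)) ∧
    treeBenefit m (fun _ => pr ++ ol) q = k + (m - 1) * (ar ∪ L).card := by
  have hA : IsPermOf (pr ++ ol) (ar ∪ L) :=
    hpr.append hol (Finset.disjoint_right.mpr fun x hx => (hdisj x hx).1)
  have hleaf : ∀ i ∈ Finset.range m, lcp (pr ++ ol) (q i) = lcp pr (q i) := by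
    intro i hi
    have him := Finset.mem_range.mp hi
    refine lcp_append_left_of_disjoint (List.disjoint_toFinset_iff_disjoint.mp ?_)
    rw [hol.2, (hq i him).2]
    exact Finset.disjoint_left.mpr fun x hx => (hdisj x hx).2 i him
  refine ⟨fun _ _ => hA, ?_⟩
  rw [treeBenefit, Finset.sum_congr rfl hleaf, ← hk, starBenefit]
  simp only [lcp_self, hA.length_eq, Finset.sum_const, Finset.card_range, smul_eq_mul]
  exact Nat.add_comm _ _
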